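/- arXiv:1002.3221 — 4 statements merged into one kernel-verified Lean document; each statement's English description precedes it below -/
import Mathlib

section
/- For every odd positive integer n, R_n(−1) = φ(n). -/
open Polynomial Finset

/-- Ramanujan sum `c_n(k) = ∑_{d ∣ gcd(n,k)} d·μ(n/d)`. -/
noncomputable def ramanujanSum (n k : ℕ) : ℤ :=
  ∑ d ∈ (Nat.gcd n k).divisors, (d : ℤ) * ArithmeticFunction.moebius (n / d)

/-- `R_n(X) = ∑_{k=0}^{n-1} c_n(k) X^k`. -/
noncomputable def R (n : ℕ) : Polynomial ℤ :=
  ∑ k ∈ Finset.range n, C (ramanujanSum n k) * X ^ k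

/-- Summing over the multiples of `d` below `d * m`. -/
theorem sum_range_mul_dvd {M : Type*} [AddCommMonoid M] (f : ℕ → M) {d : ℕ} (hd : 0 < d) (m : ℕ) :
    ∑ k ∈ Finset.range (d * m) with d ∣ k, f k = ∑ j ∈ Finset.range m, f (d * j) := by
  symm
  refine Finset.sum_nbij (d * ·) ?_ ?_ ?_ (fun _ _ => rfl)
  · intro j hj
    simpa [hd] using hj
  · exact fun a _ b _ hab => Nat.eq_of_mul_eq_mul_left hd hab
  · intro k hk
    simp only [coe_filter, Finset.mem_range, Set.mem_ofPred_eq] at hk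
    obtain ⟨hk, j, rfl⟩ := hk
    exact ⟨j, by simpa using lt_of_mul_lt_mul_left hk (Nat.zero_le d), rfl⟩

theorem ramanujanSum_eq_sum_divisors {n : ℕ} (hn : n ≠ 0) (k : ℕ) :
    ramanujanSum n k =
      ∑ d ∈ n.divisors, if d ∣ k then (d : ℤ) * ArithmeticFunction.moebius (n / d) else 0 := by
  rw [ramanujanSum, ← Finset.sum_filter]
  refine Finset.sum_congr ?_ fun _ _ => rfl
  ext d
  simp [Nat.dvd_gcd_iff, hn]

theorem sum_divisors_mul_moebius_eq_totient {n : ℕ} (hn : 0 < n) :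
    ∑ d ∈ n.divisors, (d : ℤ) * ArithmeticFunction.moebius (n / d) = (Nat.totient n : ℤ) := by
  have h := (ArithmeticFunction.sum_eq_iff_sum_mul_moebius_eq
    (f := fun m => (Nat.totient m : ℤ)) (g := fun m => (m : ℤ))).1
    (fun m _ => by exact_mod_cast Nat.sum_totient m) n hn
  rw [← h]
  refine Eq.trans ?_ (Nat.sum_divisorsAntidiagonal'
    (fun a b => ArithmeticFunction.moebius a * (b : ℤ))).symm
  exact Finset.sum_congr rfl fun d _ => mul_comm _ _

/-- For every odd positive integer `n`, `R_n(-1) = φ(n)`. -/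
theorem R_eval_neg_one_of_odd (n : ℕ) (hn : 0 < n) (hodd : Odd n) :
    (R n).eval (-1) = (Nat.totient n : ℤ) := by
  have hinner : ∀ d ∈ n.divisors,
      ∑ k ∈ Finset.range n with d ∣ k, (-1 : ℤ) ^ k = 1 := by
    intro d hd
    obtain ⟨m, rfl⟩ := Nat.dvd_of_mem_divisors hd
    obtain ⟨hd', hm⟩ := Nat.odd_mul.1 hodd
    rw [sum_range_mul_dvd _ hd'.pos]
    simp [pow_mul, hd'.neg_one_pow, neg_one_geom_sum, Nat.not_even_iff_odd.2 hm]
  calc (R n).eval (-1)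
      = ∑ k ∈ Finset.range n, ∑ d ∈ n.divisors,
          if d ∣ k then (d : ℤ) * ArithmeticFunction.moebius (n / d) * (-1) ^ k else 0 := by
        simp only [R, eval_finsetSum, eval_mul, eval_C, eval_pow, eval_X,
          ramanujanSum_eq_sum_divisors hn.ne', Finset.sum_mul, ite_mul, zero_mul]
    _ = ∑ d ∈ n.divisors, (d : ℤ) * ArithmeticFunction.moebius (n / d) := by
        rw [Finset.sum_comm]
        refine Finset.sum_congr rfl fun d hd => ?_
        rw [← Finset.sum_filter, ← Finset.mul_sum, hinner d hd, mul_one]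
    _ = (Nat.totient n : ℤ) := sum_divisors_mul_moebius_eq_totient hn
end

section
/- If n > 1 is an integer and p is a prime not dividing n, then the polynomial 1 − X^p divides R_{np}(X) in ℤ[X]. -/
open Polynomial Finset

/-- The Möbius function sums to zero over the divisors of `n > 1`. -/
theorem sum_divisors_moebius_div {n : ℕ} (hn : 1 < n) :
    ∑ d ∈ n.divisors, ArithmeticFunction.moebius (n / d) = 0 := by
  rw [Nat.sum_div_divisors n fun d => ArithmeticFunction.moebius d,
    ← ArithmeticFunction.coe_mul_zeta_apply, ArithmeticFunction.moebius_mul_coe_zeta,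
    ArithmeticFunction.one_apply_ne hn.ne']

/-- Summing over the multiples of `d` below a multiple `m * d`. -/
theorem sum_range_mul_filter_dvd {M : Type*} [AddCommMonoid M] (f : ℕ → M) (m : ℕ) {d : ℕ}
    (hd : 0 < d) :
    ∑ k ∈ range (m * d) with d ∣ k, f k = ∑ j ∈ range m, f (d * j) := by
  symm
  refine sum_bij (fun j _ => d * j) ?_ ?_ ?_ fun _ _ => rfl
  · intro j hj
    simp only [mem_filter, mem_range, dvd_mul_right, and_true] at hj ⊢
    rw [mul_comm]
    exact Nat.mul_lt_mul_of_pos_right hj hd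
  · intro i _ j _ h
    exact Nat.eq_of_mul_eq_mul_left hd h
  · intro k hk
    simp only [mem_filter, mem_range] at hk
    obtain ⟨hk, j, rfl⟩ := hk
    rw [mul_comm d j] at hk
    exact ⟨j, mem_range.2 (Nat.lt_of_mul_lt_mul_right hk), rfl⟩

/-- The Ramanujan polynomial as a sum over divisors. -/
theorem R_eq_sum_divisors (N : ℕ) :
    R N = ∑ d ∈ N.divisors,
      C ((d : ℤ) * ArithmeticFunction.moebius (N / d)) * ∑ j ∈ range (N / d), X ^ (d * j) := by
  rcases Nat.eq_zero_or_pos N with rfl | hN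
  · simp [R]
  have key : ∀ d ∈ N.divisors, ∑ j ∈ range (N / d), (X : ℤ[X]) ^ (d * j) =
      ∑ k ∈ range N with d ∣ k, X ^ k := by
    intro d hd
    have hdN := Nat.dvd_of_mem_divisors hd
    rw [← sum_range_mul_filter_dvd (fun k => (X : ℤ[X]) ^ k) (N / d) (Nat.pos_of_dvd_of_pos hdN hN),
      Nat.div_mul_cancel hdN]
  rw [sum_congr rfl fun d hd => by rw [key d hd]]
  simp_rw [mul_sum, sum_filter]
  rw [sum_comm, R]
  refine sum_congr rfl fun k _ => ?_
  have hdiv : (Nat.gcd N k).divisors = N.divisors.filter (· ∣ k) := by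
    ext d
    simp [Nat.dvd_gcd_iff, hN.ne']
  rw [ramanujanSum, hdiv, map_sum, sum_mul, sum_filter]

/-- If `x ^ p = 1`, the powers of `x` are `p`-periodic and permuted by `j ↦ d * j`. -/
theorem sum_range_pow_mul_of_coprime {A : Type*} [CommRing A] {x : A} {p d : ℕ} [NeZero p]
    (hx : x ^ p = 1) (hd : d.Coprime p) :
    ∑ j ∈ range p, x ^ (d * j) = ∑ j ∈ range p, x ^ j := by
  refine sum_bij (fun j _ => d * j % p) ?_ ?_ ?_ ?_
  · intro j _
    exact mem_range.2 (Nat.mod_lt _ (NeZero.pos p))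
  · intro i hi j hj h
    have h' : i ≡ j [MOD p] := Nat.ModEq.cancel_left_of_coprime hd.symm h
    exact h'.eq_of_lt_of_lt (mem_range.1 hi) (mem_range.1 hj)
  · intro k hk
    obtain ⟨m, hm⟩ := Nat.exists_mul_mod_eq_of_coprime k hd (NeZero.ne p)
    refine ⟨m % p, mem_range.2 (Nat.mod_lt _ (NeZero.pos p)), ?_⟩
    rw [Nat.mul_mod_mod, hm.2, Nat.mod_eq_of_lt (mem_range.1 hk)]
  · intro j _
    exact pow_eq_pow_mod _ hx

/-- The sum of the powers of `x ^ d` over `m` full periods. -/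
theorem sum_range_mul_pow_of_coprime {A : Type*} [CommRing A] {x : A} {p d : ℕ} [NeZero p]
    (hx : x ^ p = 1) (hd : d.Coprime p) (m : ℕ) :
    ∑ j ∈ range (m * p), x ^ (d * j) = m * ∑ j ∈ range p, x ^ j := by
  induction m with
  | zero => simp
  | succ m ih =>
    have hper : ∀ j, x ^ (d * (m * p + j)) = x ^ (d * j) := fun j => by
      rw [show d * (m * p + j) = p * (d * m) + d * j by ring, pow_add, pow_mul, hx, one_pow,
        one_mul]
    rw [Nat.succ_mul, sum_range_add, ih]
    simp_rw [hper]
    rw [sum_range_pow_mul_of_coprime hx hd]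
    push_cast
    ring

/-- The divisors of `n * p` are those of `n` together with their multiples by `p`. -/
theorem sum_divisors_mul_prime {M : Type*} [AddCommMonoid M] {n p : ℕ} (hp : p.Prime)
    (hpn : ¬ p ∣ n) (f : ℕ → M) :
    ∑ d ∈ (n * p).divisors, f d = ∑ d ∈ n.divisors, f d + ∑ d ∈ n.divisors, f (d * p) := by
  have hc : n.Coprime p := ((hp.coprime_iff_not_dvd).2 hpn).symm
  simp_rw [Nat.divisors_mul, mul_def]
  rw [sum_image hc.mul_injOn_divisors, sum_product, ← sum_add_distrib]
  refine sum_congr rfl fun d _ => ?_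
  rw [hp.sum_divisors, mul_one, add_comm]

/-- `R_{np}` vanishes at every `x` with `x ^ p = 1`. -/
theorem aeval_R_mul_prime {A : Type*} [CommRing A] {x : A} {n p : ℕ} (hn : 1 < n)
    (hp : p.Prime) (hpn : ¬ p ∣ n) (hx : x ^ p = 1) : aeval x (R (n * p)) = 0 := by
  have : NeZero p := ⟨hp.ne_zero⟩
  have hmoebius : ∑ d ∈ n.divisors, ((ArithmeticFunction.moebius (n / d) : ℤ) : A) = 0 := by
    rw [← Int.cast_sum, sum_divisors_moebius_div hn, Int.cast_zero]
  have hcast : ∀ d ∈ n.divisors, (d : A) * ((n / d : ℕ) : A) = n := fun d hd => by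
    rw [← Nat.cast_mul, Nat.mul_div_cancel' (Nat.dvd_of_mem_divisors hd)]
  rw [R_eq_sum_divisors, map_sum, sum_divisors_mul_prime hp hpn]
  simp only [map_mul, map_sum, map_pow, aeval_X, eq_intCast, map_intCast,
    map_natCast]
  have h₁ : ∀ d ∈ n.divisors,
      (d : A) * ((ArithmeticFunction.moebius (n * p / d) : ℤ) : A) *
        ∑ j ∈ range (n * p / d), x ^ (d * j) =
      -(n * ∑ j ∈ range p, x ^ j) * ((ArithmeticFunction.moebius (n / d) : ℤ) : A) := by
    intro d hd
    have hdn := Nat.dvd_of_mem_divisors hd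
    have hcop : ∀ {e}, e ∣ n → e.Coprime p := fun he =>
      ((hp.coprime_iff_not_dvd).2 fun h => hpn (h.trans he)).symm
    rw [Nat.mul_div_right_comm hdn, sum_range_mul_pow_of_coprime hx (hcop hdn),
      ArithmeticFunction.isMultiplicative_moebius.map_mul_of_coprime
        (hcop (Nat.div_dvd_of_dvd hdn)),
      ArithmeticFunction.moebius_apply_prime hp, ← hcast d hd]
    push_cast
    ring
  have h₂ : ∀ d ∈ n.divisors,
      ((d * p : ℕ) : A) * ((ArithmeticFunction.moebius (n * p / (d * p)) : ℤ) : A) *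
        ∑ j ∈ range (n * p / (d * p)), x ^ (d * p * j) =
      (n * p) * ((ArithmeticFunction.moebius (n / d) : ℤ) : A) := by
    intro d hd
    have hone : ∀ j, x ^ (d * p * j) = 1 := fun j => by
      rw [show d * p * j = p * (d * j) by ring, pow_mul, hx, one_pow]
    simp only [Nat.mul_div_mul_right _ _ hp.pos, hone, sum_const, card_range, nsmul_eq_mul]
    rw [← hcast d hd]
    push_cast
    ring
  rw [sum_congr rfl h₁, sum_congr rfl h₂, ← mul_sum, ← mul_sum, hmoebius, mul_zero, mul_zero,
    add_zero]

/-- If `n > 1` and `p` is a prime not dividing `n`, then `1 - X^p` divides `R_{np}` in `ℤ[X]`. -/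
theorem one_sub_X_pow_p_dvd_R (n p : ℕ) (hn : 1 < n) (hp : p.Prime) (hpn : ¬ p ∣ n) :
    (1 - X ^ p) ∣ R (n * p) := by
  have hx : AdjoinRoot.root (1 - X ^ p : ℤ[X]) ^ p = 1 := by
    have h := AdjoinRoot.mk_self (f := (1 - X ^ p : ℤ[X]))
    rw [map_sub, map_one, map_pow, AdjoinRoot.mk_X, sub_eq_zero] at h
    exact h.symm
  rw [← AdjoinRoot.mk_eq_zero, ← AdjoinRoot.aeval_eq]
  exact aeval_R_mul_prime hn hp hpn hx
end

section
/- For every positive integer n, one has the identity T_n(X) = φ(n)·(1 − X^n + Σ_{d | n} (μ(d)²/φ(d))·Ψ_d(X^{n/d})) in ℚ[X]. -/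
open Polynomial Finset

/-- `T_n(X) = ∑_{k=0}^{n-1} |c_n(k)| X^k`. -/
noncomputable def T (n : ℕ) : Polynomial ℤ :=
  ∑ k ∈ Finset.range n, C (|ramanujanSum n k|) * X ^ k


/-- `Ψ_n(X) = ∑_{1 ≤ j ≤ n, gcd(j,n)=1} X^j`. -/
noncomputable def Psi (n : ℕ) : Polynomial ℚ :=
  ∑ j ∈ (Finset.Icc 1 n).filter (fun j => Nat.gcd j n = 1), X ^ j

namespace Nat

theorem sum_divisors_moebius_mul_eq_prod_primeFactors {R : Type*} [CommRing R]
    {f : ArithmeticFunction R} (hf : f.IsMultiplicative) {n : ℕ} (hn : n ≠ 0) :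
    ∑ d ∈ n.divisors, (ArithmeticFunction.moebius d : R) * f d =
      ∏ p ∈ n.primeFactors, (1 - f p) := by
  have hprime : ∀ p ∈ n.primeFactors, p.Prime := fun p hp => prime_of_mem_primeFactors hp
  have hrad : (∏ p ∈ n.primeFactors, p).primeFactors = n.primeFactors :=
    primeFactors_prod hprime
  have hsq : Squarefree (∏ p ∈ n.primeFactors, p) :=
    Finset.squarefree_prod_of_pairwise_isCoprime
      (fun p hp q hq hpq => (Nat.coprime_iff_isRelPrime).1
        ((coprime_primes (hprime p hp) (hprime q hq)).2 hpq))
      (fun p hp => (hprime p hp).prime.squarefree)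
  rw [← hrad, hf.prodPrimeFactors_one_sub_of_squarefree f hsq]
  symm
  refine Finset.sum_subset (divisors_subset_of_dvd hn (prod_primeFactors_dvd n)) ?_
  intro e he he'
  rw [ArithmeticFunction.moebius_eq_zero_of_not_squarefree, Int.cast_zero, zero_mul]
  intro hesq
  refine he' (mem_divisors.2 ⟨?_, hsq.ne_zero⟩)
  rw [← prod_primeFactors_of_squarefree hesq]
  exact Finset.prod_dvd_prod_of_subset _ _ _ (primeFactors_mono (dvd_of_mem_divisors he) hn)

end Nat

/-- The arithmetic function `e ↦ 1 / e` restricted to the integers coprime to `m`. -/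
noncomputable def coprimeInv (m : ℕ) : ArithmeticFunction ℚ where
  toFun e := if e.Coprime m then (e : ℚ)⁻¹ else 0
  map_zero' := by simp

theorem coprimeInv_apply (m e : ℕ) :
    coprimeInv m e = if e.Coprime m then (e : ℚ)⁻¹ else 0 := rfl

theorem isMultiplicative_coprimeInv (m : ℕ) : (coprimeInv m).IsMultiplicative := by
  refine ⟨by simp [coprimeInv_apply], fun {a b} _ => ?_⟩
  simp only [coprimeInv_apply, Nat.coprime_mul_iff_left]
  split_ifs <;> simp_all [mul_comm]

theorem totient_mul_eq_totient_mul_prod {g m : ℕ} (hg : g ≠ 0) (hm : m ≠ 0) :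
    (Nat.totient (g * m) : ℚ) =
      Nat.totient m * (g * ∏ p ∈ g.primeFactors, (1 - coprimeInv m p)) := by
  have hprod : ∏ p ∈ g.primeFactors, (1 - coprimeInv m p) =
      ∏ p ∈ g.primeFactors \ m.primeFactors, (1 - (p : ℚ)⁻¹) := by
    rw [Finset.sdiff_eq_filter, Finset.prod_filter]
    refine Finset.prod_congr rfl fun p hp => ?_
    have hpp := Nat.prime_of_mem_primeFactors hp
    simp only [coprimeInv_apply, Nat.mem_primeFactors, hpp.coprime_iff_not_dvd]
    by_cases h : p ∣ m <;> simp [h, hpp, hm]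
  rw [hprod, Nat.totient_eq_mul_prod_factors, Nat.totient_eq_mul_prod_factors m,
    Nat.primeFactors_mul hg hm, ← Finset.sdiff_union_self_eq_union,
    Finset.prod_union Finset.sdiff_disjoint]
  push_cast
  ring

theorem moebius_mul_eq_ite (m e : ℕ) :
    ArithmeticFunction.moebius (m * e) = if e.Coprime m then
      ArithmeticFunction.moebius m * ArithmeticFunction.moebius e else 0 := by
  split_ifs with h
  · exact ArithmeticFunction.isMultiplicative_moebius.map_mul_of_coprime h.symm
  · exact ArithmeticFunction.moebius_eq_zero_of_not_squarefree
      fun hsq => h (Nat.coprime_of_squarefree_mul hsq).symm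

/-- Hölder's evaluation of the Ramanujan sum. -/
theorem ramanujanSum_eq_moebius_mul_totient_div {n : ℕ} (hn : 0 < n) (k : ℕ) :
    (ramanujanSum n k : ℚ) = Nat.totient n * (ArithmeticFunction.moebius (n / n.gcd k) /
      Nat.totient (n / n.gcd k)) := by
  obtain ⟨m, hnm⟩ := Nat.gcd_dvd_left n k
  have hg : 0 < n.gcd k := Nat.gcd_pos_of_pos_left k hn
  unfold ramanujanSum
  generalize n.gcd k = g at *
  subst hnm
  have hm : 0 < m := Nat.pos_of_mul_pos_left hn
  have hφ : (Nat.totient m : ℚ) ≠ 0 := by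
    exact_mod_cast (Nat.totient_pos.2 hm).ne'
  have hsum : ((∑ d ∈ g.divisors, (d : ℤ) * ArithmeticFunction.moebius (g * m / d) : ℤ) : ℚ) =
      ArithmeticFunction.moebius m * (g * ∑ e ∈ g.divisors,
        (ArithmeticFunction.moebius e : ℚ) * coprimeInv m e) := by
    rw [← Nat.sum_div_divisors, Int.cast_sum, Finset.mul_sum, Finset.mul_sum]
    refine Finset.sum_congr rfl fun e he => ?_
    obtain ⟨c, rfl⟩ := Nat.dvd_of_mem_divisors he
    have he0 : 0 < e := Nat.pos_of_mul_pos_right hg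
    have hc0 : 0 < c := Nat.pos_of_mul_pos_left hg
    have heQ : (e : ℚ) ≠ 0 := by exact_mod_cast he0.ne'
    have hdiv : e * c * m / c = m * e := by
      rw [show e * c * m = m * e * c by ring, Nat.mul_div_cancel _ hc0]
    rw [Nat.mul_div_cancel_left _ he0, hdiv, moebius_mul_eq_ite, coprimeInv_apply]
    split_ifs
    · push_cast
      field_simp
    · simp
  rw [hsum,
    Nat.sum_divisors_moebius_mul_eq_prod_primeFactors (isMultiplicative_coprimeInv m) hg.ne',
    Nat.mul_div_cancel_left _ hg, totient_mul_eq_totient_mul_prod hg.ne' hm.ne']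
  field_simp

theorem abs_ramanujanSum_eq_totient_mul {n : ℕ} (hn : 0 < n) (k : ℕ) :
    ((|ramanujanSum n k| : ℤ) : ℚ) =
      Nat.totient n * ((ArithmeticFunction.moebius (n / n.gcd k) : ℚ) ^ 2 /
        Nat.totient (n / n.gcd k)) := by
  rw [Int.cast_abs, ramanujanSum_eq_moebius_mul_totient_div hn, abs_mul, abs_div,
    Nat.abs_cast, Nat.abs_cast]
  congr 2
  rcases ArithmeticFunction.moebius_eq_or (n / n.gcd k) with h | h | h <;> simp [h]

theorem sum_divisors_mul_Psi_comp {n : ℕ} (hn : 0 < n) (a : ℕ → ℚ) :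
    ∑ d ∈ n.divisors, C (a d) * (Psi d).comp (X ^ (n / d)) =
      ∑ k ∈ Finset.Icc 1 n, C (a (n / n.gcd k)) * X ^ k := by
  have hmaps : ∀ k ∈ Finset.Icc 1 n, n / n.gcd k ∈ n.divisors := fun k _ =>
    Nat.mem_divisors.2 ⟨Nat.div_dvd_of_dvd (Nat.gcd_dvd_left n k), hn.ne'⟩
  rw [← Finset.sum_fiberwise_of_maps_to hmaps]
  refine Finset.sum_congr rfl fun d hd => ?_
  obtain ⟨m, rfl⟩ := Nat.dvd_of_mem_divisors hd
  have hd0 : 0 < d := Nat.pos_of_mul_pos_right hn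
  have hm0 : 0 < m := Nat.pos_of_mul_pos_left hn
  rw [Nat.mul_div_cancel_left _ hd0, Psi, Polynomial.sum_comp, Finset.mul_sum]
  refine Finset.sum_bij (fun j _ => j * m) ?_ ?_ ?_ ?_
  · intro j hj
    simp only [Finset.mem_filter, Finset.mem_Icc] at hj ⊢
    refine ⟨⟨Nat.mul_pos hj.1.1 hm0, Nat.mul_le_mul_right m hj.1.2⟩, ?_⟩
    rw [Nat.gcd_mul_right, Nat.gcd_comm, hj.2, one_mul, Nat.mul_div_cancel _ hm0]
  · intro i _ j _ hij
    exact Nat.eq_of_mul_eq_mul_right hm0 hij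
  · intro k hk
    simp only [Finset.mem_filter, Finset.mem_Icc] at hk
    obtain ⟨⟨hk1, hkn⟩, hkd⟩ := hk
    have hgm : (d * m).gcd k = m := by
      have h := Nat.div_mul_cancel (Nat.gcd_dvd_left (d * m) k)
      rw [hkd] at h
      exact Nat.eq_of_mul_eq_mul_left hd0 h
    obtain ⟨j, rfl⟩ : m ∣ k := hgm ▸ Nat.gcd_dvd_right (d * m) k
    refine ⟨j, ?_, mul_comm j m⟩
    simp only [Finset.mem_filter, Finset.mem_Icc]
    refine ⟨⟨Nat.pos_of_mul_pos_left hk1, ?_⟩, ?_⟩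
    · rw [mul_comm d m] at hkn
      exact Nat.le_of_mul_le_mul_left hkn hm0
    · rw [mul_comm d m, Nat.gcd_mul_left] at hgm
      rw [Nat.gcd_comm]
      exact Nat.eq_of_mul_eq_mul_left hm0 (by rw [hgm, mul_one])
  · intro j hj
    rw [Finset.mem_filter] at hj
    rw [Nat.gcd_mul_right, Nat.gcd_comm d j, hj.2, one_mul, Nat.mul_div_cancel _ hm0,
      X_pow_comp, ← pow_mul, mul_comm m j]

/-- `T_n(X) = φ(n)·(1 - X^n + ∑_{d ∣ n} (μ(d)²/φ(d))·Ψ_d(X^{n/d}))` in `ℚ[X]`. -/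
theorem T_eq_totient_mul_Psi_sum (n : ℕ) (hn : 0 < n) :
    (T n).map (Int.castRingHom ℚ) =
      C ((Nat.totient n : ℚ)) * (1 - X ^ n + ∑ d ∈ n.divisors,
        C ((ArithmeticFunction.moebius d : ℚ) ^ 2 / (Nat.totient d : ℚ)) *
          (Psi d).comp (X ^ (n / d))) := by
  have hshift : ∀ b : ℕ → ℚ[X], ∑ k ∈ Finset.range n, b k =
      b 0 - b n + ∑ k ∈ Finset.Icc 1 n, b k := by
    intro b
    have h := Finset.sum_range_succ b n
    rw [Finset.sum_range_eq_add_Ico b n.succ_pos, Nat.succ_eq_add_one, Finset.Ico_add_one_right_eq_Icc] at h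
    linear_combination -h
  rw [sum_divisors_mul_Psi_comp hn
    fun d => (ArithmeticFunction.moebius d : ℚ) ^ 2 / (Nat.totient d : ℚ)]
  have hT : (T n).map (Int.castRingHom ℚ) = C (Nat.totient n : ℚ) * ∑ k ∈ Finset.range n,
      C ((ArithmeticFunction.moebius (n / n.gcd k) : ℚ) ^ 2 /
        Nat.totient (n / n.gcd k)) * X ^ k := by
    rw [T, Polynomial.map_sum, Finset.mul_sum]
    refine Finset.sum_congr rfl fun k _ => ?_
    rw [Polynomial.map_mul, map_C, Polynomial.map_pow, map_X, eq_intCast,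
      abs_ramanujanSum_eq_totient_mul hn, C_mul, mul_assoc]
  rw [hT, hshift]
  simp [Nat.div_self hn]
end

section
/- For every odd positive integer n, one has the polynomial identity T_{2n}(X) = (1 + X^n)·T_n(X) in ℤ[X]. -/
open Polynomial Finset

theorem ramanujanSum_self_add (n k : ℕ) : ramanujanSum n (n + k) = ramanujanSum n k := by
  simp [ramanujanSum]

theorem moebius_two_mul_of_odd {m : ℕ} (hm : Odd m) :
    ArithmeticFunction.moebius (2 * m) = -ArithmeticFunction.moebius m := by
  rw [ArithmeticFunction.isMultiplicative_moebius.map_mul_of_coprime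
    (Nat.coprime_two_left.mpr hm), ArithmeticFunction.moebius_apply_prime Nat.prime_two]
  ring

theorem sum_divisors_moebius_two_mul_div {n g : ℕ} (hn : Odd n) (hg : g ∣ n) :
    ∑ d ∈ g.divisors, (d : ℤ) * ArithmeticFunction.moebius (2 * n / d) =
      -∑ d ∈ g.divisors, (d : ℤ) * ArithmeticFunction.moebius (n / d) := by
  rw [← Finset.sum_neg_distrib]
  refine Finset.sum_congr rfl fun d hd => ?_
  have hdn : d ∣ n := (Nat.dvd_of_mem_divisors hd).trans hg
  rw [Nat.mul_div_assoc _ hdn,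
    moebius_two_mul_of_odd (hn.of_dvd_nat (Nat.div_dvd_of_dvd hdn))]
  ring

theorem divisors_two_mul_of_odd {g : ℕ} (hg : Odd g) :
    (2 * g).divisors = g.divisors ∪ g.divisors.image (2 * ·) := by
  have hg0 : g ≠ 0 := hg.pos.ne'
  ext d
  simp only [Nat.mem_divisors, Finset.mem_union, Finset.mem_image]
  constructor
  · rintro ⟨hd, -⟩
    rcases Nat.even_or_odd' d with ⟨e, rfl | rfl⟩
    · exact Or.inr ⟨e, ⟨Nat.dvd_of_mul_dvd_mul_left two_pos hd, hg0⟩, rfl⟩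
    · exact Or.inl ⟨(Nat.coprime_two_right.mpr (odd_two_mul_add_one e)).dvd_of_dvd_mul_left hd,
        hg0⟩
  · rintro (⟨hd, -⟩ | ⟨e, ⟨he, -⟩, rfl⟩)
    · exact ⟨hd.mul_left 2, by simpa⟩
    · exact ⟨Nat.mul_dvd_mul_left 2 he, by simpa⟩

theorem ramanujanSum_two_mul_of_odd_of_odd {n k : ℕ} (hn : Odd n) (hk : Odd k) :
    ramanujanSum (2 * n) k = -ramanujanSum n k := by
  rw [ramanujanSum, ramanujanSum,
    (Nat.coprime_two_left.mpr hk).gcd_mul_left_cancel n]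
  exact sum_divisors_moebius_two_mul_div hn (Nat.gcd_dvd_left n k)

theorem ramanujanSum_two_mul_of_odd_of_even {n k : ℕ} (hn : Odd n) (hk : Even k) :
    ramanujanSum (2 * n) k = ramanujanSum n k := by
  obtain ⟨j, rfl⟩ := hk.two_dvd
  have hgn : n.gcd j ∣ n := Nat.gcd_dvd_left n j
  have hg : Odd (n.gcd j) := hn.of_dvd_nat hgn
  have hdisj : Disjoint (n.gcd j).divisors ((n.gcd j).divisors.image (2 * ·)) := by
    rw [Finset.disjoint_left]
    intro d hd hd'
    obtain ⟨e, -, rfl⟩ := Finset.mem_image.mp hd'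
    exact Nat.not_even_iff_odd.mpr (hg.of_dvd_nat (Nat.dvd_of_mem_divisors hd)) (even_two_mul e)
  rw [ramanujanSum, ramanujanSum, Nat.gcd_mul_left,
    (Nat.coprime_two_left.mpr hn).gcd_mul_left_cancel_right j,
    divisors_two_mul_of_odd hg, Finset.sum_union hdisj,
    sum_divisors_moebius_two_mul_div hn hgn,
    Finset.sum_image fun a _ b _ h => Nat.mul_left_cancel two_pos h]
  simp only [Nat.mul_div_mul_left _ _ two_pos, Nat.cast_mul, Nat.cast_ofNat, mul_assoc,
    ← Finset.mul_sum]
  ring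

theorem abs_ramanujanSum_two_mul_of_odd {n : ℕ} (hn : Odd n) (k : ℕ) :
    |ramanujanSum (2 * n) k| = |ramanujanSum n k| := by
  rcases Nat.even_or_odd k with hk | hk
  · rw [ramanujanSum_two_mul_of_odd_of_even hn hk]
  · rw [ramanujanSum_two_mul_of_odd_of_odd hn hk, abs_neg]

/-- For every odd positive integer `n`, `T_{2n}(X) = (1 + X^n)·T_n(X)` in `ℤ[X]`. -/
theorem T_two_mul_of_odd (n : ℕ) (hn : 0 < n) (hodd : Odd n) :
    T (2 * n) = (1 + X ^ n) * T n := by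
  simp only [T, abs_ramanujanSum_two_mul_of_odd hodd]
  rw [two_mul, Finset.sum_range_add, add_mul, one_mul, Finset.mul_sum]
  congr 1
  refine Finset.sum_congr rfl fun k _ => ?_
  rw [ramanujanSum_self_add, pow_add]
  ring
end
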